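/- arXiv:2501.04482 — 7 statements merged into one kernel-verified Lean document; each statement's English description precedes it below -/
import Mathlib

section
/- Let X be an orthoset and let Y ⊆ X be a subset containing 0, regarded as an orthoset with the restricted orthogonality relation (so that the orthocomplement in Y of B ⊆ Y is B⊥ ∩ Y). Assume that for every proper element x ∈ X there exists a subset A ⊆ Y with {x}⊥ = A⊥. Then the maps C(X) → C(Y), A ↦ A ∩ Y, and C(Y) → C(X), A ↦ A⊥⊥, are mutually inverse inclusion-preserving bijections, and moreover (A ∩ Y)⊥ ∩ Y = A⊥ ∩ Y for every A ∈ C(X); that is, they are mutually inverse ortholattice isomorphisms. -/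
/-- An orthoset (with 0): a set with a symmetric relation `perp` and an element
`zero` such that `x ⊥ x` iff `x = zero`, and `zero ⊥ x` for all `x`. -/
structure OrthoRel (X : Type*) where
  perp : X → X → Prop
  zero : X
  symm : ∀ x y, perp x y → perp y x
  perp_self_iff : ∀ x, perp x x ↔ x = zero
  zero_perp : ∀ x, perp zero x

/-- Orthocomplement of a set with respect to a relation. -/
def ocl {X : Type*} (p : X → X → Prop) (A : Set X) : Set X := {x | ∀ y ∈ A, p x y}

/-- A set is orthoclosed if it equals its double orthocomplement. -/
def IsOrthoclosed {X : Type*} (p : X → X → Prop) (A : Set X) : Prop :=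
  A = ocl p (ocl p A)

/-- `B ⊆ Y` is orthoclosed in the suborthoset `Y ⊆ X`: the orthocomplement in `Y`
of `B ⊆ Y` is `B⊥ ∩ Y`. -/
def SubClosed {X : Type*} (O : OrthoRel X) (Y : Set X) (B : Set X) : Prop :=
  B ⊆ Y ∧ B = ocl O.perp (ocl O.perp B ∩ Y) ∩ Y

theorem subset_ocl_ocl {X : Type*} (O : OrthoRel X) (A : Set X) :
    A ⊆ ocl O.perp (ocl O.perp A) :=
  fun x hx y hy => O.symm y x (hy x hx)

theorem ocl_antitone {X : Type*} (p : X → X → Prop) : Antitone (ocl p) :=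
  fun _ _ hAB _ hx y hy => hx y (hAB hy)

theorem isOrthoclosed_ocl {X : Type*} (O : OrthoRel X) (A : Set X) :
    IsOrthoclosed O.perp (ocl O.perp A) :=
  (subset_ocl_ocl O _).antisymm (ocl_antitone _ (subset_ocl_ocl O A))

/-- If every proper element has its orthocomplement realized inside `Y`, then an
orthoclosed set and its trace on `Y` have the same orthocomplement. -/
theorem ocl_inter_eq_ocl {X : Type*} (O : OrthoRel X) {Y : Set X}
    (h : ∀ x : X, x ≠ O.zero → ∃ A : Set X, A ⊆ Y ∧ ocl O.perp {x} = ocl O.perp A)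
    {A : Set X} (hA : IsOrthoclosed O.perp A) :
    ocl O.perp (A ∩ Y) = ocl O.perp A := by
  refine Set.Subset.antisymm (fun z hz a ha => ?_) (ocl_antitone _ Set.inter_subset_left)
  by_cases ha0 : a = O.zero
  · exact ha0 ▸ O.symm _ _ (O.zero_perp z)
  obtain ⟨D, hDY, hD⟩ := h a ha0
  have hDA : D ⊆ A := by
    rw [hA]
    refine (subset_ocl_ocl O D).trans (hD ▸ ?_)
    exact ocl_antitone _ (ocl_antitone _ (Set.singleton_subset_iff.2 ha))
  have hza : z ∈ ocl O.perp {a} := hD ▸ fun d hd => hz d ⟨hDA hd, hDY hd⟩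
  exact hza a rfl

/-- Lemma 2.2: for a suborthoset `Y` of `X` such that every proper element of `X` has
its orthocomplement realized as the orthocomplement of a subset of `Y`, the maps
`A ↦ A ∩ Y` and `B ↦ B⊥⊥` are mutually inverse inclusion-preserving bijections
between `C(X)` and `C(Y)`, which moreover commute with orthocomplementation. -/
theorem stmt0 {X : Type*} (O : OrthoRel X) (Y : Set X) (hY : O.zero ∈ Y)
    (h : ∀ x : X, x ≠ O.zero → ∃ A : Set X, A ⊆ Y ∧ ocl O.perp {x} = ocl O.perp A) :
    (∀ A, IsOrthoclosed O.perp A → SubClosed O Y (A ∩ Y)) ∧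
    (∀ B, SubClosed O Y B → IsOrthoclosed O.perp (ocl O.perp (ocl O.perp B))) ∧
    (∀ A, IsOrthoclosed O.perp A → ocl O.perp (ocl O.perp (A ∩ Y)) = A) ∧
    (∀ B, SubClosed O Y B → ocl O.perp (ocl O.perp B) ∩ Y = B) ∧
    (∀ A A', IsOrthoclosed O.perp A → IsOrthoclosed O.perp A' → A ⊆ A' → A ∩ Y ⊆ A' ∩ Y) ∧
    (∀ B B', SubClosed O Y B → SubClosed O Y B' → B ⊆ B' →
      ocl O.perp (ocl O.perp B) ⊆ ocl O.perp (ocl O.perp B')) ∧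
    (∀ A, IsOrthoclosed O.perp A → ocl O.perp (A ∩ Y) ∩ Y = ocl O.perp A ∩ Y) := by
  refine ⟨fun A hA => ⟨Set.inter_subset_right, ?_⟩, fun B _ => isOrthoclosed_ocl O _,
    fun A hA => ?_, fun B hB => ?_, fun A A' _ _ hAA' => Set.inter_subset_inter_left Y hAA',
    fun B B' _ _ hBB' => ocl_antitone _ (ocl_antitone _ hBB'), fun A hA => ?_⟩
  · rw [ocl_inter_eq_ocl O h hA, ocl_inter_eq_ocl O h (isOrthoclosed_ocl O A), ← hA]
  · rw [ocl_inter_eq_ocl O h hA, ← hA]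
  · rw [← ocl_inter_eq_ocl O h (isOrthoclosed_ocl O B), ← hB.2]
  · rw [ocl_inter_eq_ocl O h hA]
end

section
/- (1) If X is a Fréchet orthoset, then C(X) is a complete atomistic ortholattice, and the map X → B(C(X)), x ↦ {x, 0}, is an orthoisomorphism. (2) Conversely, if L is a complete atomistic ortholattice, then B(L) is a Fréchet orthoset and the map L → C(B(L)), a ↦ {p ∈ B(L) : p ≤ a}, is an ortholattice isomorphism. -/
/-- `X` is Fréchet. -/
def Frechet {X : Type*} (O : OrthoRel X) : Prop :=
  ∀ x y : X, x ≠ O.zero → y ≠ O.zero → x ≠ y → ∃ z, O.perp z x ∧ ¬ O.perp z y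

/-- An atom of the complete lattice `C(X)` (bottom element `{0}`). -/
def IsAtomC {X : Type*} (O : OrthoRel X) (B : Set X) : Prop :=
  IsOrthoclosed O.perp B ∧ B ≠ {O.zero} ∧
    ∀ C : Set X, IsOrthoclosed O.perp C → C ⊆ B → C = {O.zero} ∨ C = B

/-- The set of basic elements of a complete lattice: atoms and the bottom element. -/
def BL (L : Type*) [CompleteLattice L] : Type _ := {p : L // IsAtom p ∨ p = ⊥}

/-- The orthogonality relation on the basic elements of an ortholattice. -/
def bperp {L : Type*} [CompleteLattice L] (oc : L → L) (p q : BL L) : Prop :=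
  p.1 ≤ oc q.1

namespace OrthoRel

variable {X : Type*} (O : OrthoRel X) {A B : Set X} {x y : X}

theorem perp_zero (x : X) : O.perp x O.zero := O.symm _ _ (O.zero_perp x)

theorem zero_mem_ocl (A : Set X) : O.zero ∈ ocl O.perp A := fun y _ => O.zero_perp y

theorem ocl_anti (h : A ⊆ B) : ocl O.perp B ⊆ ocl O.perp A := fun _ hx y hy => hx y (h hy)

theorem subset_ocl_ocl (A : Set X) : A ⊆ ocl O.perp (ocl O.perp A) :=
  fun x hx _ hy => O.symm _ _ (hy x hx)

theorem isOrthoclosed_iff : IsOrthoclosed O.perp A ↔ ocl O.perp (ocl O.perp A) ⊆ A :=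
  ⟨fun h => h.symm.subset, fun h => (O.subset_ocl_ocl A).antisymm h⟩

theorem isOrthoclosed_ocl (A : Set X) : IsOrthoclosed O.perp (ocl O.perp A) :=
  O.isOrthoclosed_iff.2 (O.ocl_anti (O.subset_ocl_ocl A))

theorem zero_mem_of_isOrthoclosed (h : IsOrthoclosed O.perp A) : O.zero ∈ A :=
  O.isOrthoclosed_iff.1 h (O.zero_mem_ocl _)

theorem isOrthoclosed_sInter {S : Set (Set X)} (h : ∀ A ∈ S, IsOrthoclosed O.perp A) :
    IsOrthoclosed O.perp (⋂₀ S) :=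
  O.isOrthoclosed_iff.2 <| Set.subset_sInter fun A hA =>
    (O.ocl_anti (O.ocl_anti (Set.sInter_subset_of_mem hA))).trans (O.isOrthoclosed_iff.1 (h A hA))

theorem inter_ocl_self (h : IsOrthoclosed O.perp A) : A ∩ ocl O.perp A = {O.zero} := by
  refine Set.Subset.antisymm (fun x hx => (O.perp_self_iff x).1 (hx.2 x hx.1)) ?_
  rintro _ rfl
  exact ⟨O.zero_mem_of_isOrthoclosed h, O.zero_mem_ocl A⟩

theorem mem_ocl_pair : x ∈ ocl O.perp {y, O.zero} ↔ O.perp x y := by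
  refine ⟨fun h => h y (Or.inl rfl), fun h z hz => ?_⟩
  rcases hz with rfl | rfl
  exacts [h, O.perp_zero x]

theorem pair_subset (h : IsOrthoclosed O.perp A) (hx : x ∈ A) : {x, O.zero} ⊆ A :=
  Set.insert_subset hx (Set.singleton_subset_iff.2 (O.zero_mem_of_isOrthoclosed h))

theorem perp_iff_pair_subset_ocl :
    O.perp x y ↔ ({x, O.zero} : Set X) ⊆ ocl O.perp {y, O.zero} :=
  ⟨fun h => O.pair_subset (O.isOrthoclosed_ocl _) (O.mem_ocl_pair.2 h),
    fun h => O.mem_ocl_pair.1 (h (Or.inl rfl))⟩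

theorem pair_injective : Function.Injective (fun x : X => ({x, O.zero} : Set X)) := by
  intro x y h
  have hx : x ∈ ({y, O.zero} : Set X) := h.subset (Or.inl rfl)
  have hy : y ∈ ({x, O.zero} : Set X) := h.superset (Or.inl rfl)
  rcases hx with hx | hx
  · exact hx
  · rcases hy with hy | hy
    exacts [hy.symm, Eq.trans hx (Eq.symm hy)]

variable {O}

theorem isOrthoclosed_pair (hF : Frechet O) (x : X) : IsOrthoclosed O.perp {x, O.zero} := by
  refine O.isOrthoclosed_iff.2 fun y hy => ?_
  by_cases hy0 : y = O.zero
  · exact Or.inr hy0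
  refine Or.inl (by_contra fun hyx => ?_)
  have hperp : ∀ z, O.perp z x → O.perp z y :=
    fun z hz => O.symm _ _ (hy z (O.mem_ocl_pair.2 hz))
  by_cases hx0 : x = O.zero
  · exact hy0 ((O.perp_self_iff y).1 (hperp y (hx0 ▸ O.perp_zero y)))
  · obtain ⟨z, hzx, hzy⟩ := hF x y hx0 hy0 (Ne.symm hyx)
    exact hzy (hperp z hzx)

theorem isAtomC_pair (hF : Frechet O) (hx : x ≠ O.zero) : IsAtomC O {x, O.zero} := by
  refine ⟨isOrthoclosed_pair hF x, fun h => hx (h.subset (Or.inl rfl)), fun C hC hCx => ?_⟩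
  by_cases hxC : x ∈ C
  · exact Or.inr (hCx.antisymm (O.pair_subset hC hxC))
  · refine Or.inl (Set.Subset.antisymm (fun y hy => ?_)
      (Set.singleton_subset_iff.2 (O.zero_mem_of_isOrthoclosed hC)))
    rcases hCx hy with rfl | h
    exacts [absurd hy hxC, h]

theorem pair_eq_or_isAtomC (hF : Frechet O) (x : X) :
    ({x, O.zero} : Set X) = {O.zero} ∨ IsAtomC O {x, O.zero} := by
  by_cases hx : x = O.zero
  · exact Or.inl (by rw [hx, Set.pair_eq_singleton])
  · exact Or.inr (isAtomC_pair hF hx)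

theorem exists_eq_pair_of_isAtomC (hF : Frechet O) (hB : IsAtomC O B) :
    ∃ x, B = {x, O.zero} := by
  obtain ⟨hcl, hne, hmin⟩ := hB
  have h0 := O.zero_mem_of_isOrthoclosed hcl
  obtain ⟨x, hxB, hx⟩ : ∃ x ∈ B, x ≠ O.zero := by
    by_contra! h
    exact hne (Set.Subset.antisymm h (Set.singleton_subset_iff.2 h0))
  refine ⟨x, ?_⟩
  rcases hmin _ (isOrthoclosed_pair hF x) (O.pair_subset hcl hxB) with h | h
  · exact absurd (h.subset (Or.inl rfl)) hx
  · exact h.symm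

theorem eq_closure_sUnion_isAtomC (hF : Frechet O) (hA : IsOrthoclosed O.perp A) :
    A = ocl O.perp (ocl O.perp (⋃₀ {B : Set X | IsAtomC O B ∧ B ⊆ A})) := by
  refine Set.Subset.antisymm (fun x hx => ?_) ?_
  · by_cases hx0 : x = O.zero
    · exact hx0 ▸ O.zero_mem_ocl _
    · exact O.subset_ocl_ocl _
        ⟨_, ⟨isAtomC_pair hF hx0, O.pair_subset hA hx⟩, Or.inl rfl⟩
  · exact (O.ocl_anti (O.ocl_anti (Set.sUnion_subset fun B hB => hB.2))).trans
      (O.isOrthoclosed_iff.1 hA)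

end OrthoRel

namespace BL

variable {L : Type*} [CompleteLattice L] {oc : L → L}

theorem le_iff_forall_basic_le (hat : ∀ a : L, a = sSup {p : L | IsAtom p ∧ p ≤ a}) {a b : L} :
    a ≤ b ↔ ∀ p : BL L, p.1 ≤ a → p.1 ≤ b := by
  refine ⟨fun h p hp => hp.trans h, fun h => ?_⟩
  rw [hat a]
  exact sSup_le fun p hp => h ⟨p, Or.inl hp.1⟩ hp.2

theorem injective_setOf_le (hat : ∀ a : L, a = sSup {p : L | IsAtom p ∧ p ≤ a}) :
    Function.Injective (fun a : L => {p : BL L | p.1 ≤ a}) := fun _ _ h =>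
  le_antisymm ((le_iff_forall_basic_le hat).2 h.subset)
    ((le_iff_forall_basic_le hat).2 h.superset)

theorem le_oc_comm (hanti : ∀ a b : L, a ≤ b → oc b ≤ oc a) (hinv : ∀ a : L, oc (oc a) = a)
    {a b : L} : a ≤ oc b ↔ b ≤ oc a :=
  ⟨fun h => (hinv b).symm.trans_le (hanti _ _ h), fun h => (hinv a).symm.trans_le (hanti _ _ h)⟩

theorem bperp_self_iff (hcompl : ∀ a : L, a ⊓ oc a = ⊥) {p : BL L} :
    bperp oc p p ↔ p.1 = ⊥ :=
  ⟨fun h => (inf_eq_left.2 h).symm.trans (hcompl p.1), fun h => h.trans_le bot_le⟩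

theorem exists_bperp_not_bperp (hanti : ∀ a b : L, a ≤ b → oc b ≤ oc a)
    (hinv : ∀ a : L, oc (oc a) = a) (hat : ∀ a : L, a = sSup {p : L | IsAtom p ∧ p ≤ a})
    {p q : BL L} (hp : p.1 ≠ ⊥) (hq : q.1 ≠ ⊥) (hpq : p ≠ q) :
    ∃ r : BL L, bperp oc r p ∧ ¬ bperp oc r q := by
  by_contra! h
  have hqp : q.1 ≤ p.1 := by
    have := hanti _ _ ((le_iff_forall_basic_le hat).2 h)
    rwa [hinv, hinv] at this
  exact hpq (Subtype.ext (((p.2.resolve_right hp).le_iff_eq hq).1 hqp).symm)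

theorem setOf_le_oc (hanti : ∀ a b : L, a ≤ b → oc b ≤ oc a) (hinv : ∀ a : L, oc (oc a) = a)
    (hat : ∀ a : L, a = sSup {p : L | IsAtom p ∧ p ≤ a}) (a : L) :
    {p : BL L | p.1 ≤ oc a} = ocl (bperp oc) {p : BL L | p.1 ≤ a} := by
  ext p
  refine (le_oc_comm hanti hinv).trans ((le_iff_forall_basic_le hat).trans ?_)
  exact forall₂_congr fun q _ => le_oc_comm hanti hinv

theorem isOrthoclosed_setOf_le (hanti : ∀ a b : L, a ≤ b → oc b ≤ oc a)
    (hinv : ∀ a : L, oc (oc a) = a) (hat : ∀ a : L, a = sSup {p : L | IsAtom p ∧ p ≤ a})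
    (a : L) : IsOrthoclosed (bperp oc) {p : BL L | p.1 ≤ a} := by
  rw [IsOrthoclosed, ← setOf_le_oc hanti hinv hat, ← setOf_le_oc hanti hinv hat, hinv]

theorem exists_setOf_le_eq (hanti : ∀ a b : L, a ≤ b → oc b ≤ oc a)
    (hinv : ∀ a : L, oc (oc a) = a) {S : Set (BL L)} (hS : IsOrthoclosed (bperp oc) S) :
    ∃ a : L, {p : BL L | p.1 ≤ a} = S := by
  refine ⟨oc (⨆ q ∈ ocl (bperp oc) S, q.1), Eq.trans ?_ hS.symm⟩
  ext p
  refine (le_oc_comm hanti hinv).trans (iSup₂_le_iff.trans ?_)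
  exact forall₂_congr fun q _ => le_oc_comm hanti hinv

end BL

/-- Proposition 2.10: (1) if `X` is a Fréchet orthoset then `C(X)` is a complete
atomistic ortholattice and `x ↦ {x, 0}` is an orthoisomorphism from `X` onto
`B(C(X))`; (2) conversely, for any complete atomistic ortholattice `L`, `B(L)` is
a Fréchet orthoset and `a ↦ {p ∈ B(L) : p ≤ a}` is an ortholattice isomorphism
from `L` onto `C(B(L))`. -/
theorem stmt6 {X : Type u} (O : OrthoRel X) :
    (Frechet O →
      -- C(X) is a complete lattice of subsets: closed under arbitrary intersections
      ((∀ 𝒜 : Set (Set X), (∀ A ∈ 𝒜, IsOrthoclosed O.perp A) →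
          IsOrthoclosed O.perp (⋂₀ 𝒜)) ∧
        IsOrthoclosed O.perp (Set.univ : Set X) ∧
        -- ortholattice structure: the orthocomplementation
        (∀ A : Set X, IsOrthoclosed O.perp A → IsOrthoclosed O.perp (ocl O.perp A)) ∧
        (∀ A B : Set X, A ⊆ B → ocl O.perp B ⊆ ocl O.perp A) ∧
        (∀ A : Set X, IsOrthoclosed O.perp A → ocl O.perp (ocl O.perp A) = A) ∧
        (∀ A : Set X, IsOrthoclosed O.perp A → A ∩ ocl O.perp A = {O.zero}) ∧
        -- C(X) is atomistic
        (∀ A : Set X, IsOrthoclosed O.perp A →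
          A = ocl O.perp (ocl O.perp (⋃₀ {B : Set X | IsAtomC O B ∧ B ⊆ A}))) ∧
        -- x ↦ {x, 0} is an orthoisomorphism from X onto B(C(X))
        (∀ x : X, IsOrthoclosed O.perp {x, O.zero} ∧
          ({x, O.zero} = ({O.zero} : Set X) ∨ IsAtomC O {x, O.zero})) ∧
        Function.Injective (fun x : X => ({x, O.zero} : Set X)) ∧
        (∀ B : Set X, IsOrthoclosed O.perp B → (B = {O.zero} ∨ IsAtomC O B) →
          ∃ x : X, B = {x, O.zero}) ∧
        ({O.zero, O.zero} : Set X) = {O.zero} ∧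
        (∀ x y : X, O.perp x y ↔ ({x, O.zero} : Set X) ⊆ ocl O.perp {y, O.zero}))) ∧
    (∀ (L : Type u) [CompleteLattice L], ∀ oc : L → L,
      (∀ a b : L, a ≤ b → oc b ≤ oc a) →
      (∀ a : L, oc (oc a) = a) →
      (∀ a : L, a ⊓ oc a = ⊥) →
      -- L is atomistic
      (∀ a : L, a = sSup {p : L | IsAtom p ∧ p ≤ a}) →
      -- B(L) is a Fréchet orthoset (with falsity ⊥)
      ((∀ p q : BL L, bperp oc p q → bperp oc q p) ∧
        (∀ p : BL L, bperp oc p p ↔ p.1 = ⊥) ∧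
        (∀ p : BL L, (⊥ : L) ≤ oc p.1) ∧
        (∀ p q : BL L, p.1 ≠ ⊥ → q.1 ≠ ⊥ → p ≠ q →
          ∃ r : BL L, bperp oc r p ∧ ¬ bperp oc r q) ∧
        -- a ↦ {p ∈ B(L) : p ≤ a} is an ortholattice isomorphism L → C(B(L))
        (∀ a : L, IsOrthoclosed (bperp oc) {p : BL L | p.1 ≤ a}) ∧
        Function.Injective (fun a : L => {p : BL L | p.1 ≤ a}) ∧
        (∀ 𝒜 : Set (BL L), IsOrthoclosed (bperp oc) 𝒜 →
          ∃ a : L, {p : BL L | p.1 ≤ a} = 𝒜) ∧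
        (∀ a b : L, a ≤ b ↔ {p : BL L | p.1 ≤ a} ⊆ {p : BL L | p.1 ≤ b}) ∧
        (∀ a : L, {p : BL L | p.1 ≤ oc a} = ocl (bperp oc) {p : BL L | p.1 ≤ a}))) := by
  refine ⟨fun hF => ?_, fun L _ oc hanti hinv hcompl hat => ?_⟩
  · refine ⟨fun _ => O.isOrthoclosed_sInter, O.isOrthoclosed_iff.2 (Set.subset_univ _),
      fun A _ => O.isOrthoclosed_ocl A, fun _ _ => O.ocl_anti, fun _ hA => hA.symm,
      fun _ => O.inter_ocl_self, fun _ => OrthoRel.eq_closure_sUnion_isAtomC hF,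
      fun x => ⟨OrthoRel.isOrthoclosed_pair hF x, OrthoRel.pair_eq_or_isAtomC hF x⟩,
      O.pair_injective, ?_, Set.pair_eq_singleton _, fun _ _ => O.perp_iff_pair_subset_ocl⟩
    rintro B - (rfl | hB)
    · exact ⟨O.zero, (Set.pair_eq_singleton _).symm⟩
    · exact OrthoRel.exists_eq_pair_of_isAtomC hF hB
  · exact ⟨fun _ _ => (BL.le_oc_comm hanti hinv).1, fun _ => BL.bperp_self_iff hcompl,
      fun _ => bot_le, fun _ _ => BL.exists_bperp_not_bperp hanti hinv hat,
      BL.isOrthoclosed_setOf_le hanti hinv hat, BL.injective_setOf_le hat,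
      fun _ => BL.exists_setOf_le_eq hanti hinv,
      fun _ _ => BL.le_iff_forall_basic_le hat, BL.setOf_le_oc hanti hinv hat⟩
end

section
/- A map f : X → Y between orthosets is adjointable if and only if f preserves the equivalence relation ∥ and the induced map P(f) : P(X) → P(Y), [x] ↦ [f(x)], is adjointable. In this case, a map g : Y → X is an adjoint of f if and only if g preserves ∥ and P(g) is an adjoint of P(f). -/
/-- The equivalence class `[x] = {y : {y}⊥ = {x}⊥}`. -/
def eqClass {X : Type*} (O : OrthoRel X) (x : X) : Set X :=
  {y | ocl O.perp {y} = ocl O.perp {x}}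

/-- The irredundant quotient `P(X) = {[x] : x ∈ X}`. -/
def PX {X : Type*} (O : OrthoRel X) : Type _ := {A : Set X // ∃ x, A = eqClass O x}

/-- The orthogonality relation on `P(X)`: `[x] ⊥ [y]` iff `x ⊥ y`. -/
def Pperp {X : Type*} (O : OrthoRel X) (A B : PX O) : Prop :=
  ∃ x y, A.1 = eqClass O x ∧ B.1 = eqClass O y ∧ O.perp x y

/-- `g` is an adjoint of `f`: `f(x) ⊥ y` iff `x ⊥ g(y)`. -/
def IsAdjointPair {X Y : Type*} (pX : X → X → Prop) (pY : Y → Y → Prop)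
    (f : X → Y) (g : Y → X) : Prop :=
  ∀ x y, pY (f x) y ↔ pX x (g y)

/-- `f` preserves the equivalence `∥`. -/
def PreservesEquiv {X Y : Type*} (OX : OrthoRel X) (OY : OrthoRel Y) (f : X → Y) : Prop :=
  ∀ x x' : X, ocl OX.perp {x} = ocl OX.perp {x'} →
    ocl OY.perp {f x} = ocl OY.perp {f x'}

/-- The induced map `P(f) : P(X) → P(Y)`, `[x] ↦ [f(x)]` (computed via a choice of
representative; whenever `f` preserves `∥` this is exactly `[x] ↦ [f(x)]`). -/
noncomputable def Pmap {X Y : Type*} (OX : OrthoRel X) (OY : OrthoRel Y)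
    (f : X → Y) (A : PX OX) : PX OY :=
  ⟨eqClass OY (f A.2.choose), f A.2.choose, rfl⟩

namespace OrthoRel

variable {X Y : Type*} (OX : OrthoRel X) (OY : OrthoRel Y)

theorem perp_comm {x y : X} : OX.perp x y ↔ OX.perp y x :=
  ⟨OX.symm x y, OX.symm y x⟩

theorem ocl_singleton_eq_iff {x x' : X} :
    ocl OX.perp {x} = ocl OX.perp {x'} ↔ ∀ z, OX.perp x z ↔ OX.perp x' z := by
  simp [ocl, Set.ext_iff, OX.perp_comm (y := x), OX.perp_comm (y := x')]

theorem eqClass_eq_iff {x x' : X} :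
    eqClass OX x = eqClass OX x' ↔ ocl OX.perp {x} = ocl OX.perp {x'} := by
  refine ⟨fun h => ?_, fun h => by simp [eqClass, h]⟩
  have hx : x ∈ eqClass OX x := rfl
  rw [h] at hx
  exact hx

/-- The canonical projection `X → P(X)`, `x ↦ [x]`. -/
def toPX (x : X) : PX OX := ⟨eqClass OX x, x, rfl⟩

theorem toPX_eq_iff {x x' : X} :
    OX.toPX x = OX.toPX x' ↔ ocl OX.perp {x} = ocl OX.perp {x'} := by
  rw [← OX.eqClass_eq_iff]
  exact Subtype.ext_iff

theorem toPX_surjective : Function.Surjective OX.toPX := fun A =>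
  ⟨A.2.choose, Subtype.ext A.2.choose_spec.symm⟩

theorem Pperp_toPX_iff {x y : X} : Pperp OX (OX.toPX x) (OX.toPX y) ↔ OX.perp x y := by
  refine ⟨?_, fun h => ⟨x, y, rfl, rfl, h⟩⟩
  rintro ⟨x', y', hx, hy, h⟩
  have hx := OX.ocl_singleton_eq_iff.1 (OX.eqClass_eq_iff.1 hx)
  have hy := OX.ocl_singleton_eq_iff.1 (OX.eqClass_eq_iff.1 hy)
  rwa [hx, OX.perp_comm, hy, OX.perp_comm]

variable {OX OY}

theorem Pmap_toPX {f : X → Y} (hf : PreservesEquiv OX OY f) (x : X) :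
    Pmap OX OY f (OX.toPX x) = OY.toPX (f x) :=
  OY.toPX_eq_iff.2 <| hf _ _ <| OX.eqClass_eq_iff.1 (OX.toPX x).2.choose_spec.symm

/-- A map lying over `G` is an adjoint of `f` iff `G` is an adjoint of `P(f)`. -/
theorem isAdjointPair_Pmap_iff {f : X → Y} {g : Y → X} {G : PX OY → PX OX}
    (hf : PreservesEquiv OX OY f) (hG : ∀ y, G (OY.toPX y) = OX.toPX (g y)) :
    IsAdjointPair (Pperp OX) (Pperp OY) (Pmap OX OY f) G ↔
      IsAdjointPair OX.perp OY.perp f g := by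
  simp only [IsAdjointPair, OX.toPX_surjective.forall, OY.toPX_surjective.forall,
    Pmap_toPX hf, hG, Pperp_toPX_iff]

end OrthoRel

namespace IsAdjointPair

variable {X Y : Type*} {OX : OrthoRel X} {OY : OrthoRel Y} {f : X → Y} {g : Y → X}

theorem swap (h : IsAdjointPair OX.perp OY.perp f g) :
    IsAdjointPair OY.perp OX.perp g f := fun y x => by
  rw [OX.perp_comm, ← h, OY.perp_comm]

theorem preservesEquiv (h : IsAdjointPair OX.perp OY.perp f g) :
    PreservesEquiv OX OY f := fun x x' hx => by
  rw [OX.ocl_singleton_eq_iff] at hx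
  exact OY.ocl_singleton_eq_iff.2 fun y => by rw [h, h, hx]

end IsAdjointPair

/-- Proposition 3.3: `f : X → Y` is adjointable iff `f` preserves `∥` and
`P(f)` is adjointable; in this case, `g : Y → X` is an adjoint of `f` iff `g`
preserves `∥` and `P(g)` is an adjoint of `P(f)`. -/
theorem stmt8 {X Y : Type*} (OX : OrthoRel X) (OY : OrthoRel Y) (f : X → Y) :
    ((∃ g : Y → X, IsAdjointPair OX.perp OY.perp f g) ↔
      (PreservesEquiv OX OY f ∧
        ∃ G : PX OY → PX OX,
          IsAdjointPair (Pperp OX) (Pperp OY) (Pmap OX OY f) G)) ∧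
    ((∃ g : Y → X, IsAdjointPair OX.perp OY.perp f g) →
      ∀ g : Y → X,
        IsAdjointPair OX.perp OY.perp f g ↔
          (PreservesEquiv OY OX g ∧
            IsAdjointPair (Pperp OX) (Pperp OY) (Pmap OX OY f) (Pmap OY OX g))) := by
  refine ⟨⟨?_, ?_⟩, ?_⟩
  · rintro ⟨g, h⟩
    exact ⟨h.preservesEquiv, Pmap OY OX g,
      (OrthoRel.isAdjointPair_Pmap_iff h.preservesEquiv
        (OrthoRel.Pmap_toPX h.swap.preservesEquiv)).2 h⟩
  · rintro ⟨hf, G, hG⟩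
    choose g hg using fun y => OX.toPX_surjective (G (OY.toPX y))
    exact ⟨g, (OrthoRel.isAdjointPair_Pmap_iff hf fun y => (hg y).symm).1 hG⟩
  · rintro ⟨_, h₀⟩ g
    have key (hg : PreservesEquiv OY OX g) :=
      OrthoRel.isAdjointPair_Pmap_iff h₀.preservesEquiv (OrthoRel.Pmap_toPX hg)
    exact ⟨fun h => ⟨h.swap.preservesEquiv, (key h.swap.preservesEquiv).2 h⟩,
      fun ⟨hg, h⟩ => (key hg).1 h⟩
end

section
/- Let X and Y be orthosets. (i) If f : X → Y and g : Y → X are an adjoint pair, then a map h : Y → X is an adjoint of f if and only if h ∥ g, i.e., {h(y)}⊥ = {g(y)}⊥ for all y ∈ Y. (ii) Assume Y contains a proper element. Then X is irredundant if and only if every map from X to Y possesses at most one adjoint. -/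
/-- `X` is irredundant. -/
def Irredundant {X : Type*} (O : OrthoRel X) : Prop :=
  ∀ x y : X, x ≠ O.zero → y ≠ O.zero → x ≠ y →
    ∃ z, (O.perp z x ∧ ¬ O.perp z y) ∨ (O.perp z y ∧ ¬ O.perp z x)

theorem ocl_singleton_eq_iff {X : Type*} (p : X → X → Prop) (a b : X) :
    ocl p {a} = ocl p {b} ↔ ∀ z, p z a ↔ p z b := by
  simp [ocl, Set.ext_iff]

theorem OrthoRel.eq_zero_of_perp_iff {X : Type*} (O : OrthoRel X) {a b : X}
    (h : ∀ z, O.perp z a ↔ O.perp z b) (ha : a = O.zero) : b = O.zero :=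
  (O.perp_self_iff b).1 ((h b).1 (ha ▸ O.symm _ _ (O.zero_perp b)))

theorem irredundant_iff {X : Type*} (O : OrthoRel X) :
    Irredundant O ↔ ∀ a b : X, (∀ z, O.perp z a ↔ O.perp z b) → a = b := by
  constructor
  · intro hO a b h
    by_contra hab
    have ha : a ≠ O.zero := fun ha => hab (ha.trans (O.eq_zero_of_perp_iff h ha).symm)
    have hb : b ≠ O.zero := fun hb =>
      ha (O.eq_zero_of_perp_iff (fun z => (h z).symm) hb)
    obtain ⟨z, hz⟩ := hO a b ha hb hab
    have := h z
    tauto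
  · intro h x y _ _ hxy
    by_contra! hz
    exact hxy (h x y fun z => ⟨(hz z).1, (hz z).2⟩)

open Classical in
/-- For proper `c`, the map sending the complement of `{a}` to `0` and everything else to `c`
has an adjoint with the roles of `a` and `c` exchanged; `b` may replace `a` there if `{a}` and
`{b}` have the same complement. -/
theorem isAdjointPair_ite {X Y : Type*} (OX : OrthoRel X) (OY : OrthoRel Y) {a b : X} (c : Y)
    (h : ∀ z, OX.perp z a ↔ OX.perp z b) :
    IsAdjointPair OX.perp OY.perp (fun z => if OX.perp z a then OY.zero else c)
      (fun w => if OY.perp c w then OX.zero else b) := by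
  intro z w
  have h0 := OX.symm _ _ (OX.zero_perp z)
  have h1 := OY.zero_perp w
  have h2 := h z
  dsimp only
  split_ifs <;> tauto

/-- Lemma 3.4: (i) if `f`, `g` are an adjoint pair, then `h` is an adjoint of `f`
iff `h ∥ g`; (ii) provided `Y` contains a proper element, `X` is irredundant iff
every map `X → Y` has at most one adjoint. -/
theorem stmt9 {X Y : Type*} (OX : OrthoRel X) (OY : OrthoRel Y) :
    (∀ (f : X → Y) (g h : Y → X), IsAdjointPair OX.perp OY.perp f g →
      (IsAdjointPair OX.perp OY.perp f h ↔
        ∀ y : Y, ocl OX.perp {h y} = ocl OX.perp {g y})) ∧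
    ((∃ c : Y, c ≠ OY.zero) →
      (Irredundant OX ↔
        ∀ (f : X → Y) (g g' : Y → X), IsAdjointPair OX.perp OY.perp f g →
          IsAdjointPair OX.perp OY.perp f g' → g = g')) := by
  refine ⟨fun f g h hg => ?_, fun ⟨c, hc⟩ => ?_⟩
  · simp only [ocl_singleton_eq_iff]
    exact ⟨fun hh y x => (hh x y).symm.trans (hg x y),
      fun hh x y => (hg x y).trans (hh y x).symm⟩
  · rw [irredundant_iff]
    constructor
    · intro hX f g g' hg hg'
      exact funext fun y => hX _ _ fun x => (hg x y).symm.trans (hg' x y)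
    · intro hX a b hab
      have hcc : ¬ OY.perp c c := fun h => hc ((OY.perp_self_iff c).1 h)
      have := congrFun (hX _ _ _ (isAdjointPair_ite OX OY c fun _ => Iff.rfl)
        (isAdjointPair_ite OX OY c hab)) c
      simpa [hcc] using this
end

section
/- Let f : X → Y and g : Y → X be an adjoint pair of maps between orthosets. Consider the statements: (a) f is injective and im g is orthoclosed; (b) ker f = {0} and im g is orthoclosed; (c) g is surjective. Then (a) implies (b), and (b) implies (c). If X is irredundant, then (a), (b), and (c) are pairwise equivalent. -/
namespace IsAdjointPair

variable {X Y : Type*} {OX : OrthoRel X} {OY : OrthoRel Y} {f : X → Y} {g : Y → X}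

theorem map_zero (h : IsAdjointPair OX.perp OY.perp f g) : f OX.zero = OY.zero :=
  (OY.perp_self_iff _).1 ((h _ _).2 (OX.zero_perp _))

/-- The orthocomplement of the range of an adjoint of `f` is the kernel of `f`. -/
theorem ocl_range (h : IsAdjointPair OX.perp OY.perp f g) :
    ocl OX.perp (Set.range g) = {x | f x = OY.zero} := by
  ext x
  constructor
  · intro hx
    exact (OY.perp_self_iff _).1 ((h _ _).2 (hx _ ⟨f x, rfl⟩))
  · rintro hx _ ⟨y, rfl⟩
    refine (h _ _).1 ?_
    rw [show f x = OY.zero from hx]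
    exact OY.zero_perp y

theorem ker_eq_of_injective (h : IsAdjointPair OX.perp OY.perp f g)
    (hf : Function.Injective f) : {x | f x = OY.zero} = {OX.zero} := by
  ext x
  rw [Set.mem_ofPred_eq, Set.mem_singleton_iff, ← h.map_zero, hf.eq_iff]

theorem surjective_of_ker_eq (h : IsAdjointPair OX.perp OY.perp f g)
    (hker : {x | f x = OY.zero} = {OX.zero}) (hg : IsOrthoclosed OX.perp (Set.range g)) :
    Function.Surjective g := by
  intro x
  change x ∈ Set.range g
  rw [hg, h.ocl_range, hker]
  rintro _ rfl
  exact OX.symm _ _ (OX.zero_perp x)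

theorem injective_of_surjective (h : IsAdjointPair OX.perp OY.perp f g)
    (hX : Irredundant OX) (hg : Function.Surjective g) : Function.Injective f := by
  intro x x' hxx'
  have key : ∀ z, OX.perp x z ↔ OX.perp x' z := by
    intro z
    obtain ⟨y, rfl⟩ := hg z
    rw [← h, ← h, hxx']
  by_cases hx : x = OX.zero
  · subst hx
    exact ((OX.perp_self_iff _).1 ((key _).1 (OX.zero_perp _))).symm
  by_cases hx' : x' = OX.zero
  · subst hx'
    exact (OX.perp_self_iff _).1 ((key _).2 (OX.zero_perp _))
  by_contra hne
  obtain ⟨z, ⟨h₁, h₂⟩ | ⟨h₁, h₂⟩⟩ := hX x x' hx hx' hne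
  · exact h₂ (OX.symm _ _ ((key z).1 (OX.symm _ _ h₁)))
  · exact h₂ (OX.symm _ _ ((key z).2 (OX.symm _ _ h₁)))

end IsAdjointPair

theorem OrthoRel.isOrthoclosed_univ {X : Type*} (O : OrthoRel X) :
    IsOrthoclosed O.perp Set.univ := by
  refine (Set.eq_univ_of_forall fun x y hy => ?_).symm
  exact O.symm _ _ (hy x (Set.mem_univ x))

/-- Lemma 3.9: for an adjoint pair `f`, `g`: (a) `f` injective and `im g`
orthoclosed implies (b) `ker f = {0}` and `im g` orthoclosed implies (c) `g`
surjective; if `X` is irredundant, (a), (b), (c) are pairwise equivalent. -/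
theorem stmt14 {X Y : Type*} (OX : OrthoRel X) (OY : OrthoRel Y)
    (f : X → Y) (g : Y → X) (hadj : IsAdjointPair OX.perp OY.perp f g) :
    ((Function.Injective f ∧ IsOrthoclosed OX.perp (Set.range g)) →
      ({x : X | f x = OY.zero} = {OX.zero} ∧ IsOrthoclosed OX.perp (Set.range g))) ∧
    (({x : X | f x = OY.zero} = {OX.zero} ∧ IsOrthoclosed OX.perp (Set.range g)) →
      Function.Surjective g) ∧
    (Irredundant OX →
      (((Function.Injective f ∧ IsOrthoclosed OX.perp (Set.range g)) ↔
          ({x : X | f x = OY.zero} = {OX.zero} ∧ IsOrthoclosed OX.perp (Set.range g))) ∧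
        (({x : X | f x = OY.zero} = {OX.zero} ∧ IsOrthoclosed OX.perp (Set.range g)) ↔
          Function.Surjective g))) := by
  have hab (h : Function.Injective f ∧ IsOrthoclosed OX.perp (Set.range g)) :
      {x : X | f x = OY.zero} = {OX.zero} ∧ IsOrthoclosed OX.perp (Set.range g) :=
    ⟨hadj.ker_eq_of_injective h.1, h.2⟩
  have hbc (h : {x : X | f x = OY.zero} = {OX.zero} ∧ IsOrthoclosed OX.perp (Set.range g)) :
      Function.Surjective g :=
    hadj.surjective_of_ker_eq h.1 h.2
  refine ⟨hab, hbc, fun hX => ?_⟩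
  have hca (hg : Function.Surjective g) :
      Function.Injective f ∧ IsOrthoclosed OX.perp (Set.range g) :=
    ⟨hadj.injective_of_surjective hX hg, hg.range_eq ▸ OX.isOrthoclosed_univ⟩
  exact ⟨⟨hab, hca ∘ hbc⟩, ⟨hbc, hab ∘ hca⟩⟩
end

section
/- Let A be an orthoclosed subset of an orthoset X, regarded as an orthoset with the restricted relation, and let ι : A → X be the inclusion map. For a map σ : X → A the following are equivalent: (a) σ is an adjoint of ι, i.e., for all a ∈ A and x ∈ X, a ⊥ x iff a ⊥ σ(x); (b) for every x ∈ X, {a ∈ A : a ⊥ x} = {a ∈ A : a ⊥ σ(x)}; (c) for every x ∈ X, (A⊥ ∪ {x}⊥⊥)⊥⊥ = (A⊥ ∪ {σ(x)}⊥⊥)⊥⊥. Moreover, if ι possesses an adjoint σ, then the map σ̃ : X → A defined by σ̃(x) = x for x ∈ A and σ̃(x) = σ(x) otherwise is also an adjoint of ι and satisfies σ̃|_A = id_A and ker σ̃ = A⊥. -/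
theorem ocl_ocl_ocl {X : Type*} {p : X → X → Prop} (hp : ∀ x y, p x y → p y x) (S : Set X) :
    ocl p (ocl p (ocl p S)) = ocl p S := by
  ext x
  exact ⟨fun h y hy => h y fun z hz => hp _ _ (hz y hy), fun h y hy => hp _ _ (hy x h)⟩

theorem ocl_union {X : Type*} (p : X → X → Prop) (S T : Set X) :
    ocl p (S ∪ T) = ocl p S ∩ ocl p T := by
  ext x
  simp only [ocl, Set.mem_ofPred_eq, Set.mem_inter_iff, Set.mem_union, or_imp, forall_and]

/-- The orthocomplement of the join `A⊥ ∨ {x}⊥⊥` is `A ∩ {x}⊥`. -/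
theorem ocl_ocl_union_singleton {X : Type*} {p : X → X → Prop} (hp : ∀ x y, p x y → p y x)
    {A : Set X} (hA : IsOrthoclosed p A) (x : X) :
    ocl p (ocl p A ∪ ocl p (ocl p {x})) = {a | a ∈ A ∧ p a x} := by
  rw [ocl_union, ocl_ocl_ocl hp, ← hA]
  ext a
  simp [ocl]

theorem ocl_ocl_union_eq_iff {X : Type*} {p : X → X → Prop} (hp : ∀ x y, p x y → p y x)
    {A : Set X} (hA : IsOrthoclosed p A) (x y : X) :
    ocl p (ocl p (ocl p A ∪ ocl p (ocl p {x}))) = ocl p (ocl p (ocl p A ∪ ocl p (ocl p {y}))) ↔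
      {a | a ∈ A ∧ p a x} = {a | a ∈ A ∧ p a y} := by
  rw [← ocl_ocl_union_singleton hp hA x, ← ocl_ocl_union_singleton hp hA y]
  refine ⟨fun h => ?_, congrArg _⟩
  have h' := congrArg (ocl p) h
  rwa [ocl_ocl_ocl hp, ocl_ocl_ocl hp] at h'

theorem forall_perp_iff_setOf_eq {X : Type*} (p : X → X → Prop) (A : Set X) (σ : X → A) :
    (∀ a ∈ A, ∀ x : X, p a x ↔ p a (σ x).1) ↔
      ∀ x : X, {a : X | a ∈ A ∧ p a x} = {a : X | a ∈ A ∧ p a (σ x).1} := by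
  simp only [Set.ext_iff, Set.mem_ofPred_eq, and_congr_right_iff]
  exact ⟨fun h x a ha => h a ha x, fun h a ha x => h x a ha⟩

/-- The kernel of an adjoint of the inclusion of `A` is `A⊥`. -/
theorem setOf_eq_zero_eq_ocl {X : Type*} (O : OrthoRel X) {A : Set X} {σ : X → A}
    (hσ : ∀ a ∈ A, ∀ x : X, O.perp a x ↔ O.perp a (σ x).1) :
    {x : X | (σ x).1 = O.zero} = ocl O.perp A := by
  ext x
  constructor
  · intro hx a ha
    refine O.symm _ _ ((hσ a ha x).2 ?_)
    rw [show (σ x).1 = O.zero from hx]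
    exact O.symm _ _ (O.zero_perp a)
  · intro hx
    exact (O.perp_self_iff _).1 ((hσ _ (σ x).2 x).1 (O.symm _ _ (hx _ (σ x).2)))

/-- Lemma 4.8(i) and parts of 4.8(ii),(iii): for an orthoclosed subset `A` of `X`
with inclusion map `ι : A → X`, a map `σ : X → A` is an adjoint of `ι` iff
`{a ∈ A : a ⊥ x} = {a ∈ A : a ⊥ σ(x)}` for all `x`, iff
`A⊥ ∨ {x}⊥⊥ = A⊥ ∨ {σ(x)}⊥⊥` for all `x`; moreover, if `σ` is an adjoint of `ι`,
then the modification `σ̃` of `σ` which is the identity on `A` is also an adjoint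
of `ι`, satisfies `σ̃|_A = id_A`, and has kernel `A⊥`. -/
theorem stmt17 {X : Type*} (O : OrthoRel X) (A : Set X)
    (hA : IsOrthoclosed O.perp A) :
    (∀ σ : X → {a : X // a ∈ A},
      -- (a) ↔ (b)
      ((∀ a ∈ A, ∀ x : X, O.perp a x ↔ O.perp a (σ x).1) ↔
        (∀ x : X, {a : X | a ∈ A ∧ O.perp a x} = {a : X | a ∈ A ∧ O.perp a (σ x).1})) ∧
      -- (a) ↔ (c)
      ((∀ a ∈ A, ∀ x : X, O.perp a x ↔ O.perp a (σ x).1) ↔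
        (∀ x : X,
          ocl O.perp (ocl O.perp (ocl O.perp A ∪ ocl O.perp (ocl O.perp {x}))) =
            ocl O.perp (ocl O.perp (ocl O.perp A ∪ ocl O.perp (ocl O.perp {(σ x).1})))))) ∧
    (∀ σ σt : X → {a : X // a ∈ A},
      (∀ a ∈ A, ∀ x : X, O.perp a x ↔ O.perp a (σ x).1) →
      (∀ x : X, ∀ h : x ∈ A, σt x = ⟨x, h⟩) →
      (∀ x : X, x ∉ A → σt x = σ x) →
      ((∀ a ∈ A, ∀ x : X, O.perp a x ↔ O.perp a (σt x).1) ∧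
        (∀ x : X, ∀ h : x ∈ A, σt x = ⟨x, h⟩) ∧
        {x : X | (σt x).1 = O.zero} = ocl O.perp A)) := by
  refine ⟨fun σ => ⟨forall_perp_iff_setOf_eq O.perp A σ, ?_⟩, fun σ σt hσ hA_id hσt => ?_⟩
  · simp only [ocl_ocl_union_eq_iff O.symm hA]
    exact forall_perp_iff_setOf_eq O.perp A σ
  · have hadj : ∀ a ∈ A, ∀ x : X, O.perp a x ↔ O.perp a (σt x).1 := by
      intro a ha x
      by_cases hx : x ∈ A
      · rw [hA_id x hx]
      · rw [hσt x hx]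
        exact hσ a ha x
    exact ⟨hadj, hA_id, setOf_eq_zero_eq_ocl O hadj⟩
end

section
/- Let X and Y be Fréchet Dacey spaces and let f : X → Y and g : Y → X be an adjoint pair of maps such that f = f ∘ g ∘ f. Then im f is an orthoclosed subset of Y, im g is an orthoclosed subset of X, and g = g ∘ f ∘ g; that is, f is a partial orthometry with generalised inverse g. -/
/-- `X` is a Dacey space: `C(X)` is orthomodular. -/
def Dacey {X : Type*} (O : OrthoRel X) : Prop :=
  ∀ A B : Set X, IsOrthoclosed O.perp A → IsOrthoclosed O.perp B → A ⊆ B →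
    B = ocl O.perp (ocl O.perp (A ∪ (B ∩ ocl O.perp A)))

theorem ocl_anti {X : Type*} (p : X → X → Prop) {A B : Set X} (h : A ⊆ B) :
    ocl p B ⊆ ocl p A :=
  fun _ hx y hy => hx y (h hy)

/-- In a Fréchet orthoset, inclusion of the orthocomplements of two points, the second of which
is zero only if the first is, forces equality. -/
theorem Frechet.eq_of_perp_imp {X : Type*} {O : OrthoRel X} (hF : Frechet O) {x y : X}
    (h : ∀ z, O.perp z x → O.perp z y) (h0 : y = O.zero → x = O.zero) : x = y := by
  by_cases hy : y = O.zero
  · rw [hy, h0 hy]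
  by_cases hx : x = O.zero
  · subst hx
    exact absurd ((O.perp_self_iff y).1 (h y (O.symm _ _ (O.zero_perp y)))) hy
  by_contra hne
  obtain ⟨z, hzx, hzy⟩ := hF x y hx hy hne
  exact hzy (h z hzx)

theorem Frechet.eq_of_perp_iff {X : Type*} {O : OrthoRel X} (hF : Frechet O) {x y : X}
    (h : ∀ z, O.perp z x ↔ O.perp z y) : x = y := by
  refine hF.eq_of_perp_imp (fun z => (h z).1) fun hy => (O.perp_self_iff x).1 ((h x).2 ?_)
  rw [hy]
  exact O.symm _ _ (O.zero_perp x)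

theorem IsAdjointPair.swap_s19 {X Y : Type*} {OX : OrthoRel X} {OY : OrthoRel Y}
    {f : X → Y} {g : Y → X} (h : IsAdjointPair OX.perp OY.perp f g) :
    IsAdjointPair OY.perp OX.perp g f := fun y x =>
  ⟨fun k => OY.symm _ _ ((h x y).2 (OX.symm _ _ k)),
    fun k => OX.symm _ _ ((h x y).1 (OY.symm _ _ k))⟩

/-- A self-adjoint idempotent of a Fréchet Dacey space has orthoclosed range. -/
theorem isOrthoclosed_range_of_idempotent {X : Type*} (O : OrthoRel X) (hF : Frechet O)
    (hD : Dacey O) (p : X → X) (hadj : IsAdjointPair O.perp O.perp p p)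
    (hp : ∀ x, p (p x) = p x) : IsOrthoclosed O.perp (Set.range p) := by
  refine (subset_ocl_ocl O _).antisymm fun y hy => ⟨y, ?_⟩
  have hker : ∀ w, p w = O.zero → w ∈ ocl O.perp (Set.range p) := by
    rintro w hw _ ⟨x, rfl⟩
    rw [← hadj, hw]
    exact O.zero_perp x
  have hB : ({y, p y} : Set X) ⊆ ocl O.perp (ocl O.perp (Set.range p)) := by
    rintro _ (rfl | rfl)
    · exact hy
    · exact subset_ocl_ocl O _ ⟨y, rfl⟩
  have hortho := hD (ocl O.perp (ocl O.perp {p y})) (ocl O.perp (ocl O.perp {y, p y}))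
    (isOrthoclosed_ocl O _) (isOrthoclosed_ocl O _)
    (ocl_anti _ (ocl_anti _ (by simp)))
  have hzero : ∀ w ∈ ocl O.perp (ocl O.perp {y, p y}), O.perp w (p y) → w = O.zero := by
    intro w hw hwy
    have hpw : p w ∈ ocl O.perp {y, p y} := by
      rintro _ (rfl | rfl)
      · exact (hadj _ _).2 hwy
      · rw [hadj, hp]
        exact hwy
    have hpw0 : p w = O.zero := by
      rw [← O.perp_self_iff, hadj, hp]
      exact hw _ hpw
    have hw' := ocl_anti _ (ocl_anti _ hB) hw
    rw [← isOrthoclosed_ocl O (ocl O.perp (Set.range p))] at hw'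
    exact (O.perp_self_iff w).1 (hw' w (hker w hpw0))
  have hyB : y ∈ ocl O.perp (ocl O.perp {y, p y}) := subset_ocl_ocl O _ (by simp)
  refine hF.eq_of_perp_imp (fun z hz => O.symm _ _ ?_)
    fun h => ?_
  · rw [hortho] at hyB
    refine hyB z ?_
    have hzy : z ∈ ocl O.perp {p y} := by
      rintro _ rfl
      exact hz
    rintro w (hw | ⟨hw, hw'⟩)
    · exact O.symm _ _ (hw z hzy)
    · rw [hzero w hw (hw' _ (subset_ocl_ocl O _ rfl))]
      exact O.symm _ _ (O.zero_perp z)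
  · rw [← O.perp_self_iff, hadj, hp, h]
    exact O.zero_perp _

/-- If `f` has adjoint `g` and `f ∘ g ∘ f = f`, then `f` has orthoclosed range. -/
theorem IsAdjointPair.isOrthoclosed_range {X Y : Type*} {OX : OrthoRel X} {OY : OrthoRel Y}
    {f : X → Y} {g : Y → X} (hadj : IsAdjointPair OX.perp OY.perp f g)
    (hF : Frechet OY) (hD : Dacey OY) (hfgf : ∀ x, f (g (f x)) = f x) :
    IsOrthoclosed OY.perp (Set.range f) := by
  have hrange : Set.range f = Set.range fun y => f (g y) := by
    ext y
    constructor
    · rintro ⟨x, rfl⟩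
      exact ⟨f x, hfgf x⟩
    · rintro ⟨z, rfl⟩
      exact ⟨g z, rfl⟩
  rw [hrange]
  exact isOrthoclosed_range_of_idempotent OY hF hD _
    (fun y z => (hadj _ _).trans (hadj.swap_s19 _ _)) fun y => hfgf (g y)

/-- Theorem 4.13(i), "if" direction: if `f`, `g` are an adjoint pair between
Fréchet Dacey spaces with `f = f ∘ g ∘ f`, then `im f` and `im g` are orthoclosed
and `g = g ∘ f ∘ g`; that is, `f` is a partial orthometry with generalised
inverse `g`. -/
theorem stmt19 {X Y : Type*} (OX : OrthoRel X) (OY : OrthoRel Y)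
    (hXF : Frechet OX) (hXD : Dacey OX) (hYF : Frechet OY) (hYD : Dacey OY)
    (f : X → Y) (g : Y → X) (hadj : IsAdjointPair OX.perp OY.perp f g)
    (hfgf : ∀ x : X, f (g (f x)) = f x) :
    IsOrthoclosed OY.perp (Set.range f) ∧
    IsOrthoclosed OX.perp (Set.range g) ∧
    (∀ y : Y, g (f (g y)) = g y) := by
  have hgfg : ∀ y, g (f (g y)) = g y := fun y => hXF.eq_of_perp_iff fun x => by
    rw [← hadj, ← hadj.swap_s19, ← hadj, hfgf, hadj]
  exact ⟨hadj.isOrthoclosed_range hYF hYD hfgf,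
    hadj.swap_s19.isOrthoclosed_range hXF hXD hgfg, hgfg⟩
end
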